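/- Let d = 1, R an even integer with |R| ≥ 4, a ∈ ℝ \ {0}, B = {0, a}, and μ the probability measure satisfying μ = (1/2)(μ∘σ_0^{-1} + μ∘σ_a^{-1}) with σ_b(x) = x/R + b. Then L²(μ) has an orthonormal basis of exponentials {e^{2πiλx} : λ ∈ Λ} for some Λ ⊂ ℝ. -/

import Mathlib

open MeasureTheory Real ENNReal

noncomputable section

/-- `{e^{2πiλx} : λ ∈ Λ}` is an orthonormal basis of `L²(μ)`:
the exponentials are orthonormal and their orthogonal complement is trivial. -/
def IsExpONB (μ : Measure ℝ) (Λ : Set ℝ) : Prop :=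
  (∀ lam ∈ Λ, ∀ lam' ∈ Λ,
    ∫ x, (starRingEnd ℂ) (Complex.exp (2 * π * Complex.I * lam * x)) *
      Complex.exp (2 * π * Complex.I * lam' * x) ∂μ
      = if lam = lam' then 1 else 0) ∧
  (∀ g : Lp ℂ 2 μ,
    (∀ lam ∈ Λ,
      ∫ x, (starRingEnd ℂ) (Complex.exp (2 * π * Complex.I * lam * x)) *
        (g : ℝ → ℂ) x ∂μ = 0) → g = 0)

open Filter Topology

/-- The integers `∑_{k<n} ε k * R ^ k` with digits `ε k ∈ {0, 1}`. -/
def binaryDigitSums (R : ℤ) : ℕ → Finset ℤ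
  | 0 => {0}
  | n + 1 => (binaryDigitSums R n).image (fun d => R * d) ∪
      (binaryDigitSums R n).image (fun d => 1 + R * d)

/-- The product `∏_{k<n} cos² (π u / (2 R ^ k))`. -/
def cosSqProd (R : ℤ) : ℕ → ℝ → ℝ
  | 0, _ => 1
  | n + 1, u => cos (π * u / 2) ^ 2 * cosSqProd R n (u / R)

lemma mem_binaryDigitSums_succ {R : ℤ} {n : ℕ} {x : ℤ} :
    x ∈ binaryDigitSums R (n + 1) ↔
      ∃ d ∈ binaryDigitSums R n, x = R * d ∨ x = 1 + R * d := by
  simp only [binaryDigitSums, Finset.mem_union, Finset.mem_image]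
  grind

lemma binaryDigitSums_mono (R : ℤ) : Monotone (binaryDigitSums R) := by
  refine monotone_nat_of_le_succ fun n => ?_
  induction n with
  | zero => simp [binaryDigitSums]
  | succ n ih =>
    intro x hx
    rw [mem_binaryDigitSums_succ] at hx ⊢
    obtain ⟨d, hd, h⟩ := hx
    exact ⟨d, ih hd, h⟩

lemma three_mul_abs_le_of_mem_binaryDigitSums {R : ℤ} (hR : 4 ≤ |R|) {n : ℕ} {d : ℤ}
    (hd : d ∈ binaryDigitSums R n) : 3 * |d| ≤ |R| ^ n - 1 := by
  induction n generalizing d with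
  | zero => simp_all [binaryDigitSums]
  | succ n ih =>
    obtain ⟨e, he, h⟩ := mem_binaryDigitSums_succ.1 hd
    have h1 : |d| ≤ 1 + |R| * |e| := by
      rw [← abs_mul]
      rcases h with rfl | rfl
      · linarith
      · exact (abs_add_le _ _).trans (by simp)
    rw [pow_succ]
    nlinarith [ih he]

lemma cosSqProd_nonneg (R : ℤ) (n : ℕ) (u : ℝ) : 0 ≤ cosSqProd R n u := by
  induction n generalizing u with
  | zero => simp [cosSqProd]
  | succ n ih => exact mul_nonneg (sq_nonneg _) (ih _)

lemma cos_sq_sub_even {R : ℤ} (heven : Even R) (u : ℝ) (d : ℤ) :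
    cos (π * (u - R * d) / 2) ^ 2 = cos (π * u / 2) ^ 2 := by
  obtain ⟨r, rfl⟩ := heven
  have : π * (u - ((r + r : ℤ) : ℝ) * d) / 2 = π * u / 2 - ((r * d : ℤ) : ℝ) * π := by
    push_cast; ring
  rw [this, Real.cos_sub_int_mul_pi, mul_pow, ← zpow_natCast, zpow_comm]
  simp

lemma sum_cosSqProd {R : ℤ} (heven : Even R) (hR : R ≠ 0) (n : ℕ) (u : ℝ) :
    ∑ d ∈ binaryDigitSums R n, cosSqProd R n (u - d) = 1 := by
  have hR' : (R : ℝ) ≠ 0 := by exact_mod_cast hR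
  induction n generalizing u with
  | zero => simp [binaryDigitSums, cosSqProd]
  | succ n ih =>
    have hdisj : Disjoint ((binaryDigitSums R n).image (fun d => R * d))
        ((binaryDigitSums R n).image (fun d => 1 + R * d)) := by
      rw [Finset.disjoint_left]
      intro x hx hy
      obtain ⟨d, -, rfl⟩ := Finset.mem_image.1 hx
      obtain ⟨e, -, h⟩ := Finset.mem_image.1 hy
      have h1 : Even (R * d) := heven.mul_right d
      have h2 : Even (R * e) := heven.mul_right e
      grind
    have hinj : Function.Injective fun d : ℤ => R * d := mul_right_injective₀ hR
    rw [binaryDigitSums, Finset.sum_union hdisj, Finset.sum_image hinj.injOn,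
      Finset.sum_image (g := fun d => 1 + R * d)
        ((add_right_injective (1 : ℤ)).comp hinj).injOn]
    have key : ∀ v : ℝ, ∑ d ∈ binaryDigitSums R n, cosSqProd R (n + 1) (v - R * d) =
        cos (π * v / 2) ^ 2 := fun v => by
      simp only [cosSqProd, cos_sq_sub_even heven, ← Finset.mul_sum]
      calc _ = cos (π * v / 2) ^ 2 * ∑ d ∈ binaryDigitSums R n, cosSqProd R n (v / R - d) := by
            congr! 3 with d
            field_simp
        _ = _ := by rw [ih, mul_one]
    have h1 := key u
    have h2 := key (u - 1)
    have h3 : cos (π * (u - 1) / 2) = sin (π * u / 2) := by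
      rw [← cos_sub_pi_div_two]; congr 1; ring
    push_cast
    simp only [← sub_sub]
    rw [h1, h2, h3, cos_sq_add_sin_sq]

section ScalingEquation

variable {R : ℤ} {G : ℝ → ℝ}

lemma eq_cosSqProd_mul (hG : ∀ u, G u = cos (π * u / 2) ^ 2 * G (u / R)) (n : ℕ) (u : ℝ) :
    G u = cosSqProd R n u * G (u / R ^ n) := by
  induction n generalizing u with
  | zero => simp [cosSqProd]
  | succ n ih =>
    rw [hG, ih, cosSqProd, div_div, ← pow_succ', mul_assoc]

lemma exists_pos_le_of_scaling (hR : 4 ≤ |R|) (hG : ∀ u, G u = cos (π * u / 2) ^ 2 * G (u / R))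
    (hcont : Continuous G) (h0 : G 0 = 1) :
    ∃ c > 0, ∀ u, |u| ≤ 1 / 2 → c ≤ G u := by
  obtain ⟨δ, hδ, hGδ⟩ : ∃ δ > 0, ∀ u, |u| < δ → 1 / 2 ≤ G u := by
    have h : ∀ᶠ u in 𝓝 (0 : ℝ), 1 / 2 ≤ G u :=
      hcont.continuousAt.eventually (p := fun y => 1 / 2 ≤ y)
        (eventually_ge_nhds (by rw [h0]; norm_num))
    obtain ⟨δ, hδ, h⟩ := Metric.eventually_nhds_iff.1 h
    exact ⟨δ, hδ, fun u hu => h (by simpa using hu)⟩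
  have hR' : (4 : ℝ) ≤ |(R : ℝ)| := by exact_mod_cast hR
  have key : ∀ n : ℕ, ∀ u, |u| ≤ 1 / 2 → |u| < δ * 4 ^ n → (1 / 2) ^ (n + 1) ≤ G u := by
    intro n
    induction n with
    | zero => intro u _ hu; simpa using hGδ u (by simpa using hu)
    | succ n ih =>
      intro u hu hu'
      have hle : |u / R| ≤ |u| / 4 := by
        rw [abs_div]; gcongr
      have h1 : (1 / 2) ^ (n + 1) ≤ G (u / R) := by
        refine ih _ (by linarith [abs_nonneg u]) (hle.trans_lt ?_)
        rw [pow_succ] at hu'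
        linarith
      have h2 : 1 / 2 ≤ cos (π * u / 2) ^ 2 := by
        have h3 : 0 ≤ cos (2 * (π * u / 2)) := by
          rw [abs_le] at hu
          apply cos_nonneg_of_neg_pi_div_two_le_of_le <;> nlinarith [pi_pos]
        rw [cos_sq]; linarith
      rw [hG, pow_succ']
      gcongr
  obtain ⟨n, hn⟩ := pow_unbounded_of_one_lt (1 / 2 / δ) (by norm_num : (1 : ℝ) < 4)
  refine ⟨(1 / 2) ^ (n + 1), by positivity, fun u hu => key n u hu (hu.trans_lt ?_)⟩
  rwa [div_lt_iff₀' hδ] at hn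

lemma tsum_indicator_of_scaling (heven : Even R) (hR : 4 ≤ |R|)
    (hG : ∀ u, G u = cos (π * u / 2) ^ 2 * G (u / R)) (hcont : Continuous G) (h0 : G 0 = 1)
    (u : ℝ)
    (hsum : Summable ((⋃ n, (binaryDigitSums R n : Set ℤ)).indicator fun d : ℤ => G (u - d))) :
    ∑' d, (⋃ n, (binaryDigitSums R n : Set ℤ)).indicator (fun d : ℤ => G (u - d)) d = 1 := by
  obtain ⟨c, hc, hGc⟩ := exists_pos_le_of_scaling hR hG hcont h0
  have hR' : (4 : ℝ) ≤ |(R : ℝ)| := by exact_mod_cast hR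
  have hR0 : R ≠ 0 := by rintro rfl; simp at hR
  have hpow : Tendsto (fun n : ℕ => |(R : ℝ)| ^ n) atTop atTop :=
    tendsto_pow_atTop_atTop_of_one_lt (by linarith)
  have hdiv : ∀ v : ℝ, Tendsto (fun n : ℕ => v / (R : ℝ) ^ n) atTop (𝓝 0) := fun v => by
    rw [tendsto_zero_iff_norm_tendsto_zero]
    simp only [norm_div, norm_pow, Real.norm_eq_abs]
    exact hpow.const_div_atTop _
  have hGdiv : ∀ v : ℝ, Tendsto (fun n : ℕ => G (v / (R : ℝ) ^ n)) atTop (𝓝 1) := fun v => by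
    rw [← h0]; exact (hcont.tendsto 0).comp (hdiv v)
  have hlim : Tendsto (fun n : ℕ => ∑' d : ℤ,
        (binaryDigitSums R n : Set ℤ).indicator (fun d : ℤ => cosSqProd R n (u - d)) d) atTop
      (𝓝 (∑' d, (⋃ n, (binaryDigitSums R n : Set ℤ)).indicator (fun d : ℤ => G (u - d)) d)) := by
    refine tendsto_tsum_of_dominated_convergence (hsum.mul_left c⁻¹) (fun d => ?_) ?_
    · by_cases hd : d ∈ ⋃ n, (binaryDigitSums R n : Set ℤ)
      · rw [Set.indicator_of_mem hd]
        have hdiv' : Tendsto (fun n : ℕ => G (u - d) / G ((u - d) / (R : ℝ) ^ n)) atTop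
            (𝓝 (G (u - d))) := by
          simpa [Pi.div_def] using
            (tendsto_const_nhds (x := G (u - d))).div (hGdiv (u - d)) one_ne_zero
        refine hdiv'.congr' ?_
        obtain ⟨N, hN⟩ := Set.mem_iUnion.1 hd
        filter_upwards [eventually_ge_atTop N, (hGdiv (u - d)).eventually_ne one_ne_zero]
          with n hn hne
        rw [Set.indicator_of_mem (binaryDigitSums_mono R hn hN), eq_cosSqProd_mul hG n,
          mul_div_cancel_right₀ _ hne]
      · rw [Set.indicator_of_notMem hd]
        refine tendsto_const_nhds.congr fun n => ?_
        rw [Set.indicator_of_notMem fun h => hd (Set.mem_iUnion.2 ⟨n, h⟩)]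
    · filter_upwards [hpow.eventually_ge_atTop (6 * |u|)] with n hn d
      by_cases hd : d ∈ binaryDigitSums R n
      · rw [Set.indicator_of_mem (by exact_mod_cast hd),
          Set.indicator_of_mem (Set.mem_iUnion.2 ⟨n, by exact_mod_cast hd⟩),
          Real.norm_of_nonneg (cosSqProd_nonneg _ _ _), eq_cosSqProd_mul hG n, inv_mul_eq_div,
          le_div_iff₀ hc]
        gcongr
        · exact cosSqProd_nonneg _ _ _
        · apply hGc
          have h3 : 3 * |(d : ℝ)| ≤ |(R : ℝ)| ^ n - 1 := by
            exact_mod_cast three_mul_abs_le_of_mem_binaryDigitSums hR hd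
          rw [abs_div, abs_pow, div_le_iff₀ (by positivity)]
          linarith [abs_sub u d]
      · rw [Set.indicator_of_notMem (by exact_mod_cast hd), norm_zero]
        refine mul_nonneg (inv_nonneg.2 hc.le) (Set.indicator_nonneg (fun d _ => ?_) _)
        obtain ⟨n, hn⟩ := ((hGdiv (u - d)).eventually (eventually_ge_nhds zero_lt_one)).exists
        rw [eq_cosSqProd_mul hG n]
        exact mul_nonneg (cosSqProd_nonneg _ _ _) hn
  refine tendsto_nhds_unique hlim ?_
  refine tendsto_const_nhds.congr fun n => ?_
  rw [tsum_eq_sum (s := binaryDigitSums R n)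
    (fun d hd => Set.indicator_of_notMem (by exact_mod_cast hd) _), ← sum_cosSqProd heven hR0 n u]
  exact Finset.sum_congr rfl fun d hd =>
    (Set.indicator_of_mem (f := fun d : ℤ => cosSqProd R n (u - d)) (by exact_mod_cast hd)).symm

lemma eq_zero_of_mem_binaryDigitSums (heven : Even R)
    (hG : ∀ u, G u = cos (π * u / 2) ^ 2 * G (u / R)) {n : ℕ} {x y : ℤ}
    (hx : x ∈ binaryDigitSums R n) (hy : y ∈ binaryDigitSums R n) (hne : x ≠ y) :
    G (x - y) = 0 := by
  have hodd : ∀ k : ℤ, G (2 * k + 1) = 0 := fun k => by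
    simp [hG (2 * k + 1), (cos_eq_zero_iff (θ := π * (2 * k + 1) / 2)).2 ⟨k, by ring⟩]
  obtain ⟨r, rfl⟩ := heven
  induction n generalizing x y with
  | zero =>
    exact absurd ((Finset.mem_singleton.1 hx).trans (Finset.mem_singleton.1 hy).symm) hne
  | succ n ih =>
    obtain ⟨d, hd, hx⟩ := mem_binaryDigitSums_succ.1 hx
    obtain ⟨e, he, hy⟩ := mem_binaryDigitSums_succ.1 hy
    have hscale : x - y = (r + r) * (d - e) → G (x - y) = 0 := fun h => by
      have hde : d ≠ e := by rintro rfl; simp at h; omega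
      have hr : ((r + r : ℤ) : ℝ) ≠ 0 := by
        intro h0
        rw [Int.cast_eq_zero.1 h0] at h
        omega
      have h' : (x - y : ℝ) = ((r + r : ℤ) : ℝ) * (d - e) := by exact_mod_cast h
      rw [hG, h', mul_div_cancel_left₀ _ hr, ih hde hd he, mul_zero]
    rcases hx with rfl | rfl <;> rcases hy with rfl | rfl
    · exact hscale (by ring)
    · convert hodd (r * (d - e) - 1) using 2; push_cast; ring
    · convert hodd (r * (d - e)) using 2; push_cast; ring
    · exact hscale (by ring)

end ScalingEquation

section Exponentials

variable (μ : Measure ℝ) [IsFiniteMeasure μ]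

lemma norm_exp_two_pi_I_mul (t x : ℝ) : ‖Complex.exp (2 * π * Complex.I * t * x)‖ = 1 := by
  rw [← Complex.norm_exp_ofReal_mul_I (2 * π * t * x)]
  congr 2; push_cast; ring

lemma memLp_exp_two_pi_I_mul (t : ℝ) :
    MemLp (fun x : ℝ => Complex.exp (2 * π * Complex.I * t * x)) 2 μ :=
  MemLp.of_bound (by fun_prop) 1 (ae_of_all _ fun x => (norm_exp_two_pi_I_mul t x).le)

/-- The exponential `x ↦ e^{2πitx}` as an element of `L²(μ)`. -/
def expLp (t : ℝ) : Lp ℂ 2 μ := (memLp_exp_two_pi_I_mul μ t).toLp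

lemma inner_expLp_left (t : ℝ) (g : Lp ℂ 2 μ) :
    inner ℂ (expLp μ t) g =
      ∫ x, (starRingEnd ℂ) (Complex.exp (2 * π * Complex.I * t * x)) * (g : ℝ → ℂ) x ∂μ := by
  rw [L2.inner_def]
  refine integral_congr_ae ?_
  filter_upwards [(memLp_exp_two_pi_I_mul μ t).coeFn_toLp] with x hx
  rw [RCLike.inner_apply, expLp, hx, mul_comm]

lemma inner_expLp_expLp_eq_integral (s t : ℝ) :
    inner ℂ (expLp μ s) (expLp μ t) =
      ∫ x, (starRingEnd ℂ) (Complex.exp (2 * π * Complex.I * s * x)) *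
        Complex.exp (2 * π * Complex.I * t * x) ∂μ := by
  rw [inner_expLp_left]
  refine integral_congr_ae ?_
  filter_upwards [(memLp_exp_two_pi_I_mul μ t).coeFn_toLp] with x hx
  rw [expLp, hx]

lemma inner_expLp_expLp (s t : ℝ) :
    inner ℂ (expLp μ s) (expLp μ t) = charFun μ (2 * π * (t - s)) := by
  rw [inner_expLp_expLp_eq_integral, charFun_apply_real]
  congr! 2 with x
  rw [← Complex.exp_conj, ← Complex.exp_add]
  congr 1
  simp [map_ofNat]
  ring

end Exponentials

section Probability

variable (μ : Measure ℝ) [IsProbabilityMeasure μ]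

lemma inner_expLp_self (t : ℝ) : inner ℂ (expLp μ t) (expLp μ t) = 1 := by
  rw [inner_expLp_expLp]
  simp

lemma norm_expLp (t : ℝ) : ‖expLp μ t‖ = 1 := by
  rw [norm_eq_sqrt_re_inner (𝕜 := ℂ), inner_expLp_self]
  simp

end Probability

/-- A vector attaining equality in Bessel's inequality is orthogonal to everything that is
orthogonal to the orthonormal family. -/
lemma Orthonormal.inner_eq_zero_of_tsum_eq {ι E : Type*} [NormedAddCommGroup E]
    [InnerProductSpace ℂ E] {v : ι → E} (hv : Orthonormal ℂ v) {x g : E}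
    (hx : ∑' i, ‖inner ℂ (v i) x‖ ^ 2 = ‖x‖ ^ 2) (hg : ∀ i, inner ℂ (v i) g = 0) :
    inner ℂ x g = 0 := by
  have hle : ∀ w ∈ Submodule.span ℂ {g}, ‖x - 0‖ ≤ ‖x - w‖ := by
    intro w hw
    obtain ⟨c, rfl⟩ := Submodule.mem_span_singleton.1 hw
    have h := hv.tsum_inner_products_le (x - c • g)
    simp only [inner_sub_right, inner_smul_right, hg, mul_zero, sub_zero, hx] at h
    simpa using pow_le_pow_iff_left₀ (norm_nonneg _) (norm_nonneg _) two_ne_zero |>.1 h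
  have hinf : ‖x - 0‖ = ⨅ w : Submodule.span ℂ {g}, ‖x - w‖ :=
    le_antisymm (le_ciInf fun w => hle w w.2)
      (ciInf_le ⟨0, by rintro _ ⟨w, rfl⟩; exact norm_nonneg _⟩ (0 : Submodule.span ℂ {g}))
  have h := (Submodule.norm_eq_iInf_iff_inner_eq_zero _ (Submodule.zero_mem _)).1 hinf g
    (Submodule.mem_span_singleton_self g)
  simpa using h

lemma integrable_exp_mul {μ : Measure ℝ} {g : ℝ → ℂ} (hg : Integrable g μ) (t : ℝ) :
    Integrable (fun x : ℝ => Complex.exp (t * x * Complex.I) * g x) μ := by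
  refine hg.bdd_mul (c := 1) (by fun_prop) (ae_of_all _ fun x => ?_)
  rw [← Complex.ofReal_mul, Complex.norm_exp_ofReal_mul_I]

section Uniqueness

variable {μ : Measure ℝ} [IsFiniteMeasure μ]

/-- Fourier uniqueness for real densities. -/
lemma ae_eq_zero_of_integral_exp_mul_ofReal_eq_zero {h : ℝ → ℝ} (hh : Integrable h μ)
    (hzero : ∀ t : ℝ, ∫ x, Complex.exp (t * x * Complex.I) * (h x : ℂ) ∂μ = 0) :
    h =ᵐ[μ] 0 := by
  have hfin : ∀ k : ℝ → ℝ, Integrable k μ →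
      IsFiniteMeasure (μ.withDensity fun x => ENNReal.ofReal (k x)) := fun k hk =>
    isFiniteMeasure_withDensity_ofReal hk.2
  have hchar : ∀ k : ℝ → ℝ, Integrable k μ → ∀ t,
      charFun (μ.withDensity fun x => ENNReal.ofReal (k x)) t =
        ∫ x, Complex.exp (t * x * Complex.I) * ((max (k x) 0 : ℝ) : ℂ) ∂μ := fun k hk t => by
    rw [charFun_apply_real, integral_withDensity_eq_integral_toReal_smul₀
      hk.aestronglyMeasurable.aemeasurable.ennreal_ofReal (by simp)]
    congr! 2 with x
    rw [ENNReal.toReal_ofReal', Complex.real_smul, mul_comm]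
  have := hfin h hh
  have hneg : Integrable (fun x => -h x) μ := hh.neg
  have := hfin _ hneg
  have heq : (μ.withDensity fun x => ENNReal.ofReal (h x)) =
      μ.withDensity fun x => ENNReal.ofReal (-h x) := by
    refine Measure.ext_of_charFun (funext fun t => ?_)
    have hp : Integrable (fun x => ((max (h x) 0 : ℝ) : ℂ)) μ := hh.pos_part.ofReal
    have hn : Integrable (fun x => ((max (-h x) 0 : ℝ) : ℂ)) μ := hh.neg_part.ofReal
    rw [hchar h hh, hchar _ hneg, ← sub_eq_zero,
      ← integral_sub (integrable_exp_mul hp t) (integrable_exp_mul hn t), ← hzero t]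
    congr! 2 with x
    rw [← mul_sub, ← Complex.ofReal_sub]
    congr 2
    rcases le_total 0 (h x) with h0 | h0 <;> simp [h0]
  have hae := (withDensity_eq_iff_of_sigmaFinite
    hh.aestronglyMeasurable.aemeasurable.ennreal_ofReal
    hneg.aestronglyMeasurable.aemeasurable.ennreal_ofReal).1 heq
  filter_upwards [hae] with x hx
  rcases le_total 0 (h x) with h0 | h0
  · rw [ENNReal.ofReal_of_nonpos (neg_nonpos.2 h0), ENNReal.ofReal_eq_zero] at hx
    exact le_antisymm hx h0
  · rw [ENNReal.ofReal_of_nonpos h0, eq_comm, ENNReal.ofReal_eq_zero] at hx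
    exact le_antisymm h0 (by simpa using hx)

/-- Fourier uniqueness for complex densities. -/
lemma ae_eq_zero_of_integral_exp_mul_eq_zero {g : ℝ → ℂ} (hg : Integrable g μ)
    (hzero : ∀ t : ℝ, ∫ x, Complex.exp (t * x * Complex.I) * g x ∂μ = 0) :
    g =ᵐ[μ] 0 := by
  have hconj : ∀ t : ℝ, ∫ x, Complex.exp (t * x * Complex.I) * (starRingEnd ℂ) (g x) ∂μ = 0 := by
    intro t
    have h := congrArg (starRingEnd ℂ) (hzero (-t))
    rw [← integral_conj, map_zero] at h
    rw [← h]
    congr! 2 with x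
    rw [map_mul, ← Complex.exp_conj]
    simp
  have hgc : Integrable (fun x => (starRingEnd ℂ) (g x)) μ := by
    simpa using (Complex.conjCLE : ℂ →L[ℝ] ℂ).integrable_comp hg
  have hre : (fun x => (g x).re) =ᵐ[μ] 0 := by
    refine ae_eq_zero_of_integral_exp_mul_ofReal_eq_zero hg.re fun t => ?_
    simp only [Complex.re_eq_add_conj, mul_div_assoc', mul_add]
    rw [integral_div, integral_add (integrable_exp_mul hg t) (integrable_exp_mul hgc t),
      hzero, hconj]
    simp
  have him : (fun x => (g x).im) =ᵐ[μ] 0 := by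
    refine ae_eq_zero_of_integral_exp_mul_ofReal_eq_zero hg.im fun t => ?_
    simp only [Complex.im_eq_sub_conj, mul_div_assoc', mul_sub]
    rw [integral_div, integral_sub (integrable_exp_mul hg t) (integrable_exp_mul hgc t),
      hzero, hconj]
    simp
  filter_upwards [hre, him] with x h1 h2
  exact Complex.ext h1 h2

lemma eq_zero_of_inner_expLp_eq_zero {g : Lp ℂ 2 μ} (h : ∀ t, inner ℂ (expLp μ t) g = 0) :
    g = 0 := by
  refine (Lp.eq_zero_iff_ae_eq_zero).2
    (ae_eq_zero_of_integral_exp_mul_eq_zero ((Lp.memLp g).integrable one_le_two) fun t => ?_)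
  rw [← h (-t / (2 * π)), inner_expLp_left]
  congr! 2 with x
  rw [← Complex.exp_conj]
  congr 1
  have : (π : ℂ) ≠ 0 := by exact_mod_cast pi_ne_zero
  simp
  field_simp

end Uniqueness

lemma charFun_of_selfSimilar {R a : ℝ} {μ : Measure ℝ} [IsFiniteMeasure μ]
    (hμ : μ = (1/2 : ℝ≥0∞) • (μ.map (fun x => x / R) + μ.map (fun x => x / R + a))) (s : ℝ) :
    charFun μ s = (1 + Complex.exp ((s * a : ℝ) * Complex.I)) / 2 * charFun μ (s / R) := by
  have h1 : ∫ x, Complex.exp (s * x * Complex.I) ∂(μ.map fun x => x / R) =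
      charFun μ (s / R) := by
    rw [integral_map (by fun_prop) (by fun_prop), charFun_apply_real]
    congr! 4 with x
    push_cast; ring
  have h2 : ∫ x, Complex.exp (s * x * Complex.I) ∂(μ.map fun x => x / R + a) =
      Complex.exp ((s * a : ℝ) * Complex.I) * charFun μ (s / R) := by
    rw [integral_map (by fun_prop) (by fun_prop), charFun_apply_real, ← integral_const_mul]
    congr! 2 with x
    rw [← Complex.exp_add]
    congr 1
    push_cast; ring
  have hexp_int : ∀ ν : Measure ℝ, IsFiniteMeasure ν →
      Integrable (fun x : ℝ => Complex.exp (s * x * Complex.I)) ν := fun ν _ => by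
    simpa using integrable_exp_mul (μ := ν) (integrable_const 1) s
  conv_lhs => rw [hμ]
  rw [charFun_apply_real, integral_smul_measure,
    integral_add_measure (hexp_int _ inferInstance) (hexp_int _ inferInstance), h1, h2]
  simp only [one_div, ENNReal.toReal_inv, ENNReal.toReal_ofNat, Complex.real_smul]
  push_cast; ring

lemma norm_one_add_exp_div_two_sq (θ : ℝ) :
    ‖(1 + Complex.exp (θ * Complex.I)) / 2‖ ^ 2 = cos (θ / 2) ^ 2 := by
  rw [cos_sq, mul_div_cancel₀ _ two_ne_zero, norm_div, div_pow, ← Complex.normSq_eq_norm_sq,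
    Complex.normSq_apply]
  simp [Complex.exp_ofReal_mul_I_re, Complex.exp_ofReal_mul_I_im]
  nlinarith [sin_sq_add_cos_sq θ]

/-- For even `R` with `|R| ≥ 4` and any `a ≠ 0`, the self-similar measure of the IFS
`{x/R, x/R + a}` with equal weights admits an orthonormal basis of exponentials. -/
theorem exponential_basis_even_scale
    (R : ℤ) (heven : Even R) (hR : 4 ≤ |R|) (a : ℝ) (ha : a ≠ 0)
    (μ : Measure ℝ) (hP : IsProbabilityMeasure μ)
    (hμ : μ = (1/2 : ℝ≥0∞) • (μ.map (fun x => x / (R : ℝ)) +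
      μ.map (fun x => x / (R : ℝ) + a))) :
    ∃ Λ : Set ℝ, IsExpONB μ Λ := by
  set G : ℝ → ℝ := fun u => ‖charFun μ (π * u / a)‖ ^ 2 with hGdef
  have hG : ∀ u, G u = cos (π * u / 2) ^ 2 * G (u / R) := fun u => by
    simp only [hGdef]
    rw [charFun_of_selfSimilar hμ, norm_mul, mul_pow, norm_one_add_exp_div_two_sq,
      div_mul_cancel₀ _ ha, div_right_comm, mul_div_assoc π u (R : ℝ)]
  have hcont : Continuous G := by
    have := continuous_charFun (μ := μ)
    fun_prop
  have h0 : G 0 = 1 := by simp [hGdef]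
  have hinner : ∀ (t : ℝ) (d : ℤ),
      ‖inner ℂ (expLp μ (d / (2 * a))) (expLp μ t)‖ ^ 2 = G (2 * a * t - d) := fun t d => by
    rw [inner_expLp_expLp]
    simp only [hGdef]
    congr 3
    field_simp
  set S : Set ℤ := ⋃ n, (binaryDigitSums R n : Set ℤ)
  have horth : ∀ d ∈ S, ∀ e ∈ S, d ≠ e →
      inner ℂ (expLp μ (d / (2 * a))) (expLp μ (e / (2 * a))) = 0 := by
    intro d hd e he hne
    obtain ⟨m, hm⟩ := Set.mem_iUnion.1 hd
    obtain ⟨n, hn⟩ := Set.mem_iUnion.1 he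
    have h := eq_zero_of_mem_binaryDigitSums heven hG
      (binaryDigitSums_mono R (le_max_right m n) hn)
      (binaryDigitSums_mono R (le_max_left m n) hm) hne.symm
    rwa [← mul_div_cancel₀ (e : ℝ) (mul_ne_zero two_ne_zero ha), ← hinner, sq_eq_zero_iff,
      norm_eq_zero] at h
  have hon : Orthonormal ℂ fun d : S => expLp μ ((d : ℤ) / (2 * a)) := by
    refine ⟨fun d => ?_, fun d e hne => horth d d.2 e e.2 fun h => hne (Subtype.ext h)⟩
    exact norm_expLp μ _
  have hparseval : ∀ t, ∑' d : S, ‖inner ℂ (expLp μ ((d : ℤ) / (2 * a))) (expLp μ t)‖ ^ 2 =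
      ‖expLp μ t‖ ^ 2 := fun t => by
    have hsum := hon.inner_products_summable (expLp μ t)
    simp only [hinner] at hsum ⊢
    have h1 := tsum_indicator_of_scaling heven hR hG hcont h0 (2 * a * t)
      (summable_subtype_iff_indicator.1 hsum)
    rw [← tsum_subtype] at h1
    rw [h1, norm_expLp, one_pow]
  refine ⟨(fun d : ℤ => (d : ℝ) / (2 * a)) '' S, ?_, ?_⟩
  · rintro _ ⟨d, hd, rfl⟩ _ ⟨e, he, rfl⟩
    rw [← inner_expLp_expLp_eq_integral]
    by_cases hde : d = e
    · subst hde
      simpa using inner_expLp_self μ _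
    · rw [if_neg, horth d hd e he hde]
      intro h
      exact hde (by exact_mod_cast (div_left_inj' (mul_ne_zero two_ne_zero ha)).1 h)
  · intro g hg
    refine eq_zero_of_inner_expLp_eq_zero fun t => hon.inner_eq_zero_of_tsum_eq (hparseval t) ?_
    intro d
    rw [inner_expLp_left]
    exact hg _ ⟨d, d.2, rfl⟩

end
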